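/- arXiv:2012.07058 — 2 statements merged into one kernel-verified Lean document; each statement's English description precedes it below -/
import Mathlib

section
/- Expected simple regret of the purely observational algorithm (OBS-ALG, Theorem 1): Suppose the algorithm draws B i.i.d. samples from ν, and assume B is large enough that 2·sqrt((1/B)·ln(16pMB)) ≤ p. Let a_B be the arm in 𝒜 with the largest empirical mean estimate (p̂, μ̂ as defined) after the B samples. Then E[max_{a∈𝒜} μ_a − μ_{a_B}] ≤ 1/(16·M·p²·B²) + sqrt((8/(p·B))·ln(16·p·M·B)). -/
open MeasureTheory Real

/-- A joint observation `(X_1,…,X_M, Y)` with all coordinates in `{0,1}`. -/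
abbrev ObsVec (M : ℕ) := (Fin M → Bool) × Bool

/-- real-valued indicator of a boolean. -/
def indR (b : Bool) : ℝ := if b then 1 else 0

/-- `p_{i,x} = P(X_i = x)` under `ν`. -/
noncomputable def pix {M : ℕ} (ν : Measure (ObsVec M)) (i : Fin M) (x : Bool) : ℝ :=
  (ν {v | v.1 i = x}).toReal

/-- `p = min_{i,x} p_{i,x}`. -/
noncomputable def pmin {M : ℕ} (ν : Measure (ObsVec M)) : ℝ :=
  sInf (Set.range fun q : Fin M × Bool => pix ν q.1 q.2)

/-- `μ_0 = E[Y]`. -/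
noncomputable def mu0 {M : ℕ} (ν : Measure (ObsVec M)) : ℝ :=
  (ν {v | v.2 = true}).toReal

/-- `μ_{i,x} = E[Y | X_i = x]` (for `{0,1}`-valued `Y`). -/
noncomputable def muix {M : ℕ} (ν : Measure (ObsVec M)) (i : Fin M) (x : Bool) : ℝ :=
  (ν {v | v.1 i = x ∧ v.2 = true}).toReal / pix ν i x

/-- Arms: `none` is the observational arm `a_0`, `some (i,x)` is `a_{i,x}`. -/
abbrev Arm (M : ℕ) := Option (Fin M × Bool)

/-- mean reward of an arm. -/
noncomputable def armMean {M : ℕ} (ν : Measure (ObsVec M)) : Arm M → ℝ :=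
  fun a => a.elim (mu0 ν) fun q => muix ν q.1 q.2

/-- `max_{a ∈ 𝒜} μ_a`. -/
noncomputable def maxMean {M : ℕ} (ν : Measure (ObsVec M)) : ℝ :=
  sSup (Set.range (armMean ν))

/-- number of samples `t ≤ B` with `X_i^t = x`. -/
def cnt {M B : ℕ} (ω : Fin B → ObsVec M) (i : Fin M) (x : Bool) : ℕ :=
  (Finset.univ.filter fun t : Fin B => (ω t).1 i = x).card

/-- empirical estimate `p̂_{i,x} = (1/B)∑_t 1{X_i^t = x}`. -/
noncomputable def phat {M B : ℕ} (ω : Fin B → ObsVec M) (i : Fin M) (x : Bool) : ℝ :=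
  (cnt ω i x : ℝ) / B

/-- empirical estimate `μ̂_0 = (1/B)∑_t Y^t`. -/
noncomputable def muhat0 {M B : ℕ} (ω : Fin B → ObsVec M) : ℝ :=
  (∑ t : Fin B, indR (ω t).2) / B

/-- empirical estimate `μ̂_{i,x} = (∑_t Y^t·1{X_i^t = x})/(∑_t 1{X_i^t = x})`,
`0` when the denominator is `0`. -/
noncomputable def muhatix {M B : ℕ} (ω : Fin B → ObsVec M) (i : Fin M) (x : Bool) : ℝ :=
  if cnt ω i x = 0 then 0
  else (∑ t : Fin B, if (ω t).1 i = x ∧ (ω t).2 = true then (1 : ℝ) else 0) / (cnt ω i x : ℝ)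

/-- empirical estimate of the mean reward of each arm. -/
noncomputable def armEst {M B : ℕ} (ω : Fin B → ObsVec M) : Arm M → ℝ :=
  fun a => a.elim (muhat0 ω) fun q => muhatix ω q.1 q.2

open ProbabilityTheory in
/-- Hoeffding's lemma for a centred Bernoulli variable, in closed form. -/
lemma bernoulli_centered_mgf_le {q : ℝ} (h0 : 0 ≤ q) (h1 : q ≤ 1) (l : ℝ) :
    (1 - q) * exp (-(l * q)) + q * exp (l * (1 - q)) ≤ exp (l ^ 2 / 8) := by
  have h1' : 0 ≤ 1 - q := by linarith
  let m : Measure ℝ :=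
    ENNReal.ofReal (1 - q) • Measure.dirac 0 + ENNReal.ofReal q • Measure.dirac 1
  have hm (f : ℝ → ℝ) : ∫ x, f x ∂m = (1 - q) * f 0 + q * f 1 := by
    rw [integral_add_measure, integral_smul_measure, integral_smul_measure, integral_dirac,
      integral_dirac, ENNReal.toReal_ofReal h1', ENNReal.toReal_ofReal h0, smul_eq_mul,
      smul_eq_mul]
    · exact (integrable_dirac (by simp)).smul_measure ENNReal.ofReal_ne_top
    · exact (integrable_dirac (by simp)).smul_measure ENNReal.ofReal_ne_top
  have : IsProbabilityMeasure m := ⟨by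
    simp only [m, Measure.add_apply, Measure.smul_apply, measure_univ, smul_eq_mul, mul_one]
    rw [← ENNReal.ofReal_add h1' h0]
    simp⟩
  have hb : ∀ᵐ x ∂m, id x ∈ Set.Icc (0 : ℝ) 1 := by
    rw [ae_add_measure_iff]
    refine ⟨Measure.ae_smul_measure ?_ _, Measure.ae_smul_measure ?_ _⟩ <;>
      simp [ae_dirac_eq]
  have key := (hasSubgaussianMGF_of_mem_Icc (μ := m) aemeasurable_id hb).mgf_le l
  simp only [mgf, hm] at key
  convert key using 1
  · simp only [id]
    ring_nf
  · simp only [sub_zero, nnnorm_one, NNReal.coe_pow, NNReal.coe_div, NNReal.coe_one]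
    congr 1
    push_cast
    ring

/-- Chernoff bound for i.i.d. samples: a sum of i.i.d. variables whose exponential has mean at most
one is at least `c` with probability at most `exp (-c)`. -/
lemma measureReal_pi_le_sum_le_exp_neg {Ω : Type*} [MeasurableSpace Ω] {B : ℕ} (ν : Measure Ω)
    [IsProbabilityMeasure ν] {g : Ω → ℝ} (hint : Integrable (fun v => exp (g v)) ν)
    (hg : ∫ v, exp (g v) ∂ν ≤ 1) (c : ℝ) :
    (Measure.pi fun _ : Fin B => ν).real {ω | c ≤ ∑ t, g (ω t)} ≤ exp (-c) := by
  have h := ProbabilityTheory.measure_ge_le_exp_mul_mgf (μ := Measure.pi fun _ : Fin B => ν)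
    (X := fun ω => ∑ t, g (ω t)) (t := 1) c zero_le_one (by
      simp only [one_mul, exp_sum]
      exact Integrable.fintype_prod (f := fun _ v => exp (g v)) fun _ => hint)
  refine h.trans ?_
  have hpow : ProbabilityTheory.mgf (fun ω : Fin B → Ω => ∑ t, g (ω t))
      (Measure.pi fun _ : Fin B => ν) 1 = (∫ v, exp (g v) ∂ν) ^ B := by
    simp only [ProbabilityTheory.mgf, one_mul, exp_sum]
    rw [integral_fintype_prod_eq_pow (f := fun v => exp (g v)), Fintype.card_fin]
  rw [hpow, neg_one_mul]
  exact mul_le_of_le_one_right (exp_pos _).le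
    (pow_le_one₀ (integral_nonneg fun _ => (exp_pos _).le) hg)

/-- Number of samples that land in `S`. -/
noncomputable def sampleCount {Ω : Type*} {B : ℕ} (S : Set Ω) (ω : Fin B → Ω) : ℝ :=
  ∑ t, S.indicator 1 (ω t)

lemma sampleCount_univ {Ω : Type*} {B : ℕ} (ω : Fin B → Ω) :
    sampleCount Set.univ ω = B := by
  simp [sampleCount]

/-- Exponential tail bound for the deviation of the count of `C` from its conditional expectation
given the count of `A ⊇ C`. -/
lemma measureReal_pi_conditional_deviation_le {Ω : Type*} [MeasurableSpace Ω] {B : ℕ}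
    (ν : Measure Ω) [IsProbabilityMeasure ν] {A C : Set Ω} (hA : MeasurableSet A)
    (hC : MeasurableSet C) (hCA : C ⊆ A) {q : ℝ} (h0 : 0 ≤ q) (h1 : q ≤ 1)
    (hq : ν.real C = q * ν.real A) (l c : ℝ) :
    (Measure.pi fun _ : Fin B => ν).real
      {ω | c ≤ l * (sampleCount C ω - q * sampleCount A ω) - l ^ 2 / 8 * sampleCount A ω}
      ≤ exp (-c) := by
  set g : Ω → ℝ := fun v =>
    l * (C.indicator 1 v - q * A.indicator 1 v) - l ^ 2 / 8 * A.indicator 1 v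
  have hexp : (fun v => exp (g v)) = fun v =>
      1 + (C.indicator (fun _ => exp (l * (1 - q) - l ^ 2 / 8) - exp (-(l * q) - l ^ 2 / 8)) v
        + A.indicator (fun _ => exp (-(l * q) - l ^ 2 / 8) - 1) v) := by
    funext v
    by_cases hvC : v ∈ C
    · have hvA := hCA hvC
      simp [g, hvC, hvA]
    · by_cases hvA : v ∈ A <;> simp [g, hvC, hvA]
  have hiC := (integrable_const (μ := ν)
    (exp (l * (1 - q) - l ^ 2 / 8) - exp (-(l * q) - l ^ 2 / 8))).indicator hC
  have hiA := (integrable_const (μ := ν) (exp (-(l * q) - l ^ 2 / 8) - 1)).indicator hA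
  have hint : Integrable (fun v => exp (g v)) ν := by
    rw [hexp]
    exact (integrable_const _).add (hiC.add hiA)
  have hle : ∫ v, exp (g v) ∂ν ≤ 1 := by
    rw [hexp, integral_add (integrable_const _) (by exact hiC.add hiA), integral_add hiC hiA,
      integral_indicator_const _ hC, integral_indicator_const _ hA, hq]
    simp only [integral_const, probReal_univ, smul_eq_mul, mul_one]
    have hb := mul_le_mul_of_nonneg_left (bernoulli_centered_mgf_le h0 h1 l)
      (exp_pos (-(l ^ 2 / 8))).le
    rw [← exp_add, neg_add_cancel, exp_zero] at hb
    have e1 : exp (l * (1 - q) - l ^ 2 / 8) = exp (-(l ^ 2 / 8)) * exp (l * (1 - q)) := by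
      rw [← exp_add]; ring_nf
    have e2 : exp (-(l * q) - l ^ 2 / 8) = exp (-(l ^ 2 / 8)) * exp (-(l * q)) := by
      rw [← exp_add]; ring_nf
    rw [e1, e2]
    nlinarith [mul_le_mul_of_nonneg_left hb (measureReal_nonneg (μ := ν) (s := A))]
  convert measureReal_pi_le_sum_le_exp_neg (B := B) ν hint hle c using 5 with ω
  simp only [sampleCount, g, Finset.sum_sub_distrib, Finset.mul_sum, mul_sub]

/-- Two-sided deviation of an empirical conditional frequency on the event that the conditioning
event is sampled at least `m` times. -/
lemma measureReal_pi_abs_deviation_le {Ω : Type*} [MeasurableSpace Ω] {B : ℕ}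
    (ν : Measure Ω) [IsProbabilityMeasure ν] {A C : Set Ω} (hA : MeasurableSet A)
    (hC : MeasurableSet C) (hCA : C ⊆ A) {q : ℝ} (h0 : 0 ≤ q) (h1 : q ≤ 1)
    (hq : ν.real C = q * ν.real A) {e : ℝ} (he : 0 ≤ e) (m : ℝ) :
    (Measure.pi fun _ : Fin B => ν).real
      {ω | m ≤ sampleCount A ω ∧ e * sampleCount A ω ≤ |sampleCount C ω - q * sampleCount A ω|}
      ≤ 2 * exp (-(2 * e ^ 2 * m)) := by
  have hup := measureReal_pi_conditional_deviation_le (B := B) ν hA hC hCA h0 h1 hq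
    (4 * e) (2 * e ^ 2 * m)
  have hlo := measureReal_pi_conditional_deviation_le (B := B) ν hA hC hCA h0 h1 hq
    (-(4 * e)) (2 * e ^ 2 * m)
  refine (measureReal_mono ?_).trans ((measureReal_union_le _ _).trans
    ((add_le_add hup hlo).trans (two_mul _).ge))
  rintro ω ⟨hm, hd⟩
  have hm' := mul_le_mul_of_nonneg_left hm (sq_nonneg e)
  rcases le_abs.1 hd with h | h
  · left
    have := mul_le_mul_of_nonneg_left h he
    simp only [Set.mem_ofPred_eq]
    nlinarith
  · right
    have := mul_le_mul_of_nonneg_left h he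
    simp only [Set.mem_ofPred_eq]
    nlinarith

/-- An event of probability at least `p` is sampled fewer than `p * B / 2` times with small
probability. -/
lemma measureReal_pi_sampleCount_lt_le {Ω : Type*} [MeasurableSpace Ω] {B : ℕ}
    (ν : Measure Ω) [IsProbabilityMeasure ν] {A : Set Ω} (hA : MeasurableSet A)
    {p : ℝ} (hp : 0 ≤ p) (hpA : p ≤ ν.real A) :
    (Measure.pi fun _ : Fin B => ν).real {ω | sampleCount A ω < p * B / 2}
      ≤ exp (-(p ^ 2 * B / 2)) := by
  refine (measureReal_mono ?_).trans (measureReal_pi_conditional_deviation_le (B := B) ν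
    MeasurableSet.univ hA (Set.subset_univ _) measureReal_nonneg measureReal_le_one
    (by simp) (-(2 * p)) (p ^ 2 * B / 2))
  intro ω hω
  simp only [Set.mem_ofPred_eq, sampleCount_univ] at hω ⊢
  have h2 := mul_le_mul_of_nonneg_left hω.le hp
  have h3 := mul_le_mul_of_nonneg_left hpA (mul_nonneg hp (Nat.cast_nonneg (α := ℝ) B))
  nlinarith

/-- The event on which an arm's reward is conditioned. -/
def armEvent {M : ℕ} (a : Arm M) : Set (ObsVec M) :=
  a.elim Set.univ fun q => {v | v.1 q.1 = q.2}

/-- The event that an arm's conditioning event holds and the reward is one. -/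
def rewardEvent {M : ℕ} (a : Arm M) : Set (ObsVec M) :=
  armEvent a ∩ {v | v.2 = true}

lemma armMean_eq_div {M : ℕ} (ν : Measure (ObsVec M)) [IsProbabilityMeasure ν] (a : Arm M) :
    armMean ν a = ν.real (rewardEvent a) / ν.real (armEvent a) := by
  rcases a with _ | q
  · simp [armMean, mu0, rewardEvent, armEvent, Measure.real]
  · simp only [armMean, muix, pix, rewardEvent, armEvent, Measure.real, Option.elim]
    rfl

lemma armEst_eq_div {M B : ℕ} (ω : Fin B → ObsVec M) (a : Arm M) :
    armEst ω a = sampleCount (rewardEvent a) ω / sampleCount (armEvent a) ω := by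
  rcases a with _ | ⟨i, x⟩
  · have huniv : sampleCount (armEvent (none : Arm M)) ω = B := sampleCount_univ ω
    rw [huniv]
    simp only [armEst, muhat0, armEvent, rewardEvent, Option.elim, Set.univ_inter, sampleCount,
      Set.indicator_apply, Set.mem_ofPred_eq, Pi.one_apply, indR]
  · have hcnt : (cnt ω i x : ℝ) = sampleCount (armEvent (some (i, x))) ω := by
      simp [cnt, sampleCount, armEvent, Set.indicator_apply]
    simp only [armEst, muhatix, Option.elim, ← hcnt]
    split_ifs with h
    · simp [h]
    · simp [sampleCount, rewardEvent, armEvent, Set.indicator_apply]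

lemma armMean_nonneg {M : ℕ} (ν : Measure (ObsVec M)) [IsProbabilityMeasure ν] (a : Arm M) :
    0 ≤ armMean ν a := by
  rw [armMean_eq_div]
  positivity

lemma armMean_le_one {M : ℕ} (ν : Measure (ObsVec M)) [IsProbabilityMeasure ν] (a : Arm M) :
    armMean ν a ≤ 1 := by
  rw [armMean_eq_div]
  exact div_le_one_of_le₀ (measureReal_mono Set.inter_subset_left) measureReal_nonneg

lemma maxMean_le {M : ℕ} (ν : Measure (ObsVec M)) {r : ℝ} (h : ∀ a, armMean ν a ≤ r) :
    maxMean ν ≤ r :=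
  csSup_le (Set.range_nonempty _) (Set.forall_mem_range.2 h)

lemma pmin_le_pix {M : ℕ} (ν : Measure (ObsVec M)) (i : Fin M) (x : Bool) :
    pmin ν ≤ pix ν i x :=
  csInf_le (Set.finite_range _).bddBelow ⟨(i, x), rfl⟩

lemma pmin_le_one {M : ℕ} (hM : 0 < M) (ν : Measure (ObsVec M)) [IsProbabilityMeasure ν] :
    pmin ν ≤ 1 :=
  (pmin_le_pix ν ⟨0, hM⟩ true).trans measureReal_le_one

lemma pmin_le_measureReal_armEvent {M : ℕ} (hM : 0 < M) (ν : Measure (ObsVec M))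
    [IsProbabilityMeasure ν] (a : Arm M) : pmin ν ≤ ν.real (armEvent a) := by
  rcases a with _ | ⟨i, x⟩
  · simpa [armEvent] using pmin_le_one hM ν
  · exact pmin_le_pix ν i x

/-- With high probability the empirical mean of a single arm is accurate. -/
lemma measureReal_pi_lt_abs_armEst_sub_le {M B : ℕ} (hM : 0 < M) (hB : 0 < B)
    (ν : Measure (ObsVec M)) [IsProbabilityMeasure ν] (hp : 0 < pmin ν) {e : ℝ} (he : 0 ≤ e)
    (a : Arm M) :
    (Measure.pi fun _ : Fin B => ν).real {ω | e < |armEst ω a - armMean ν a|}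
      ≤ 2 * exp (-(e ^ 2 * (pmin ν * B))) + exp (-((pmin ν) ^ 2 * B / 2)) := by
  have hpA := pmin_le_measureReal_armEvent hM ν a
  have hdev := measureReal_pi_abs_deviation_le (B := B) ν (A := armEvent a) (C := rewardEvent a)
    .of_discrete .of_discrete Set.inter_subset_left (armMean_nonneg ν a) (armMean_le_one ν a)
    (by rw [armMean_eq_div, div_mul_cancel₀ _ (hp.trans_le hpA).ne']) he (pmin ν * B / 2)
  have hcount := measureReal_pi_sampleCount_lt_le (B := B) ν (A := armEvent a) .of_discrete
    hp.le hpA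
  rw [show 2 * e ^ 2 * (pmin ν * B / 2) = e ^ 2 * (pmin ν * B) by ring] at hdev
  refine (measureReal_mono ?_).trans ((measureReal_union_le _ _).trans (add_le_add hdev hcount))
  intro ω hω
  rcases lt_or_ge (sampleCount (armEvent a) ω) (pmin ν * B / 2) with h | h
  · exact Or.inr h
  · refine Or.inl ⟨h, ?_⟩
    have hpos : 0 < sampleCount (armEvent a) ω := by
      have : (0 : ℝ) < B := by exact_mod_cast hB
      exact lt_of_lt_of_le (by positivity) h
    have hω' : e < |armEst ω a - armMean ν a| := hω
    rw [armEst_eq_div, div_sub' hpos.ne', abs_div, abs_of_pos hpos, lt_div_iff₀ hpos,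
      mul_comm (sampleCount (armEvent a) ω)] at hω'
    exact hω'.le

/-- Playing an empirically best arm costs at most `2 * e` if all empirical means are `e`-accurate. -/
lemma maxMean_sub_armMean_le {M B : ℕ} (ν : Measure (ObsVec M)) (ω : Fin B → ObsVec M) {e : ℝ}
    {b : Arm M} (hb : ∀ a, armEst ω a ≤ armEst ω b)
    (he : ∀ a, |armEst ω a - armMean ν a| ≤ e) :
    maxMean ν - armMean ν b ≤ 2 * e := by
  have : maxMean ν ≤ armMean ν b + 2 * e := maxMean_le ν fun a => by
    have h1 := abs_le.1 (he a)
    have h2 := abs_le.1 (he b)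
    linarith [hb a, h1.1, h2.2]
  linarith

/-- expected simple regret of the purely observational algorithm
(OBS-ALG, Theorem 1).  `aB ω` is an arm with the largest empirical mean estimate
after `B` i.i.d. samples `ω` from `ν`. -/
theorem obs_alg_expected_simple_regret
    (M B : ℕ) (hM : 2 ≤ M) (hB : 0 < B)
    (ν : Measure (ObsVec M)) [IsProbabilityMeasure ν]
    (hp : 0 < pmin ν)
    (hBlarge : 2 * Real.sqrt ((1 / (B : ℝ)) * Real.log (16 * pmin ν * M * B)) ≤ pmin ν)
    (aB : (Fin B → ObsVec M) → Arm M)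
    (haB : ∀ ω a, armEst ω a ≤ armEst ω (aB ω))
    (haBmeas : Measurable fun ω : Fin B → ObsVec M => armMean ν (aB ω)) :
    ∫ ω, (maxMean ν - armMean ν (aB ω)) ∂(Measure.pi fun _ : Fin B => ν)
      ≤ 1 / (16 * M * (pmin ν) ^ 2 * (B : ℝ) ^ 2)
        + Real.sqrt ((8 / (pmin ν * B)) * Real.log (16 * pmin ν * M * B)) := by
  have hM' : (2 : ℝ) ≤ M := by exact_mod_cast hM
  have hB' : (0 : ℝ) < B := by exact_mod_cast hB
  have hp1 : pmin ν ≤ 1 := pmin_le_one (by omega) ν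
  set p := pmin ν with hpdef
  set u := 16 * p * M * B with hu
  have hu0 : 0 < u := by positivity
  set P := Measure.pi fun _ : Fin B => ν
  have hreg1 (ω) : maxMean ν - armMean ν (aB ω) ≤ 1 := by
    linarith [maxMean_le ν (armMean_le_one ν), armMean_nonneg ν (aB ω)]
  rcases le_or_gt u 1 with hu1 | hu1
  · have hint : ∫ ω, (maxMean ν - armMean ν (aB ω)) ∂P ≤ ∫ _, (1 : ℝ) ∂P :=
      integral_mono .of_finite .of_finite hreg1
    simp only [integral_const, probReal_univ, smul_eq_mul, mul_one] at hint
    have : 1 ≤ 1 / (16 * M * p ^ 2 * (B : ℝ) ^ 2) := by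
      rw [le_div_iff₀ (by positivity)]
      have hpB : p * B ≤ 1 := by nlinarith [mul_pos hp hB']
      nlinarith [mul_le_mul hu1 hpB (by positivity) zero_le_one]
    linarith [Real.sqrt_nonneg (8 / (p * B) * Real.log u)]
  · have hL : 0 < Real.log u := Real.log_pos hu1
    set L := Real.log u
    have hpL : 2 * L ≤ p ^ 2 * B / 2 := by
      have h := pow_le_pow_left₀ (by positivity) hBlarge 2
      rw [mul_pow, Real.sq_sqrt (by positivity)] at h
      have h' := mul_le_mul_of_nonneg_right h hB'.le
      rw [show 2 ^ 2 * (1 / (B : ℝ) * L) * B = 4 * L by field_simp; norm_num] at h'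
      linarith
    set e := Real.sqrt (8 / (p * B) * L) / 2 with he
    have he2 : e ^ 2 * (p * B) = 2 * L := by
      rw [he, div_pow, Real.sq_sqrt (by positivity)]
      field_simp
      norm_num
    have harm (a : Arm M) : P.real {ω | e < |armEst ω a - armMean ν a|} ≤ 3 * (u ^ 2)⁻¹ := by
      have h := measureReal_pi_lt_abs_armEst_sub_le (by omega) hB ν hp (e := e) (by positivity) a
      rw [← hpdef, he2] at h
      have hexp : exp (-(2 * L)) = (u ^ 2)⁻¹ := by
        rw [exp_neg, two_mul, exp_add, exp_log hu0, sq]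
      have := exp_le_exp.2 (neg_le_neg hpL)
      rw [hexp] at h this
      linarith
    set bad : Set (Fin B → ObsVec M) := ⋃ a : Arm M, {ω | e < |armEst ω a - armMean ν a|}
    have hbad : P.real bad ≤ 1 / (16 * M * p ^ 2 * (B : ℝ) ^ 2) := by
      refine (measureReal_iUnion_fintype_le _).trans ((Finset.sum_le_sum fun a _ => harm a).trans ?_)
      simp only [Finset.sum_const, Finset.card_univ, Fintype.card_option, Fintype.card_prod,
        Fintype.card_fin, Fintype.card_bool, nsmul_eq_mul]
      have : 1 / (16 * M * p ^ 2 * (B : ℝ) ^ 2) = 16 * M * (u ^ 2)⁻¹ := by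
        rw [hu]
        field_simp
      rw [this, ← mul_assoc]
      refine mul_le_mul_of_nonneg_right ?_ (by positivity)
      push_cast
      linarith
    calc ∫ ω, (maxMean ν - armMean ν (aB ω)) ∂P
        ≤ ∫ ω, (bad.indicator 1 ω + 2 * e) ∂P := by
          refine integral_mono .of_finite .of_finite fun ω => ?_
          have he0 : 0 ≤ e := by positivity
          by_cases hω : ω ∈ bad
          · simpa [hω] using (hreg1 ω).trans (by linarith)
          · simp only [Set.indicator_of_notMem hω, zero_add]
            refine maxMean_sub_armMean_le ν ω (haB ω) fun a => ?_
            by_contra! h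
            exact hω (Set.mem_iUnion.2 ⟨a, h⟩)
      _ = P.real bad + 2 * e := by
          rw [integral_add .of_finite .of_finite, integral_indicator_one .of_discrete]
          simp
      _ ≤ _ := by
          rw [he, mul_div_cancel₀ _ two_ne_zero]
          linarith
end

section
/- Stability of the effective sparsity parameter m(·) (Lemma 4): Let M ≥ 2 and let q, q̂ ∈ [0,1]^M be such that p := min_{i} min(q_i, 1−q_i) > 0 and |q̂_i − q_i| ≤ p/4 for every i ∈ {1,…,M}. Then (2/5)·m(q) ≤ m(q̂) ≤ 2·m(q). -/
open scoped Classical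

/-- `I_τ(q) = {i : min(q_i, 1 − q_i) < 1/τ}`. -/
noncomputable def Ival (M : ℕ) (q : Fin M → ℝ) (τ : ℕ) : Finset (Fin M) :=
  Finset.univ.filter fun i => min (q i) (1 - q i) < 1 / (τ : ℝ)

/-- `m(q) = min{τ ∈ {2,…,M} : |I_τ(q)| ≤ τ}`. -/
noncomputable def mval (M : ℕ) (q : Fin M → ℝ) : ℕ :=
  sInf {τ : ℕ | 2 ≤ τ ∧ τ ≤ M ∧ (Ival M q τ).card ≤ τ}

/-- `p = min_i min(q_i, 1 − q_i)`. -/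
noncomputable def pminVec (M : ℕ) (q : Fin M → ℝ) : ℝ :=
  sInf (Set.range fun i : Fin M => min (q i) (1 - q i))

theorem mval_mem (M : ℕ) (hM : 2 ≤ M) (q : Fin M → ℝ) :
    2 ≤ mval M q ∧ mval M q ≤ M ∧ (Ival M q (mval M q)).card ≤ mval M q :=
  Nat.sInf_mem (s := {τ : ℕ | 2 ≤ τ ∧ τ ≤ M ∧ (Ival M q τ).card ≤ τ})
    ⟨M, hM, le_rfl, (Finset.card_le_univ _).trans (Fintype.card_fin M).le⟩

theorem mval_le_two_mul (M : ℕ) (hM : 2 ≤ M) (q r : Fin M → ℝ)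
    (h : ∀ i, min (q i) (1 - q i) ≤ 2 * min (r i) (1 - r i)) :
    mval M r ≤ 2 * mval M q := by
  obtain ⟨h2, hle, hcard⟩ := mval_mem M hM q
  by_cases hlt : 2 * mval M q ≤ M
  · refine Nat.sInf_le ⟨by omega, hlt, ?_⟩
    refine (Finset.card_le_card fun i hi => ?_).trans (hcard.trans (by omega))
    simp only [Ival, Finset.mem_filter, Finset.mem_univ, true_and] at hi ⊢
    have hpos : (0 : ℝ) < mval M q := by exact_mod_cast (by omega : 0 < mval M q)
    have heq : 1 / ((2 * mval M q : ℕ) : ℝ) = 1 / (mval M q : ℝ) / 2 := by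
      push_cast
      field_simp
    rw [heq] at hi
    linarith [h i]
  · exact (mval_mem M hM r).2.1.trans (by omega)

theorem pminVec_le (M : ℕ) (q : Fin M → ℝ) (i : Fin M) :
    pminVec M q ≤ min (q i) (1 - q i) :=
  csInf_le (Set.finite_range _).bddBelow (Set.mem_range_self i)

theorem abs_min_one_sub_sub_le (x y : ℝ) :
    |min x (1 - x) - min y (1 - y)| ≤ |x - y| := by
  refine (abs_min_sub_min_le_max _ _ _ _).trans (max_le le_rfl ?_)
  rw [sub_sub_sub_cancel_left, abs_sub_comm]

/-- stability of the effective sparsity parameter `m(·)` (Lemma 4). -/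
theorem mval_stability (M : ℕ) (hM : 2 ≤ M) (q qhat : Fin M → ℝ)
    (hq : ∀ i, q i ∈ Set.Icc (0 : ℝ) 1) (hqhat : ∀ i, qhat i ∈ Set.Icc (0 : ℝ) 1)
    (hp : 0 < pminVec M q)
    (hdev : ∀ i, |qhat i - q i| ≤ pminVec M q / 4) :
    (2 : ℝ) / 5 * (mval M q : ℝ) ≤ (mval M qhat : ℝ) ∧
      (mval M qhat : ℝ) ≤ 2 * (mval M q : ℝ) := by
  have hclose (i : Fin M) :=
    abs_le.mp ((abs_min_one_sub_sub_le (qhat i) (q i)).trans (hdev i))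
  have hlower := mval_le_two_mul M hM qhat q fun i => by
    linarith [(hclose i).2, pminVec_le M q i]
  have hupper := mval_le_two_mul M hM q qhat fun i => by
    linarith [(hclose i).1, pminVec_le M q i]
  have hlower' : (mval M q : ℝ) ≤ 2 * mval M qhat := by exact_mod_cast hlower
  exact ⟨by linarith [(mval M qhat).cast_nonneg (α := ℝ)], by exact_mod_cast hupper⟩
end
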